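/- A von Neumann algebra M is almost *-clean (every element is the sum of a projection and a non-zero-divisor) if and only if M is finite. -/

import Mathlib

variable {H : Type*} [NormedAddCommGroup H] [InnerProductSpace ℂ H] [CompleteSpace H]

namespace VonNeumannAlgebra

/-- Two bounded operators that agree on a subspace and on its orthogonal complement are equal. -/
theorem eq_of_eqOn_of_eqOn_orthogonal {A B : H →L[ℂ] H} (D : Submodule ℂ H)
    (h₁ : ∀ x ∈ D, A x = B x) (h₂ : ∀ x ∈ Dᗮ, A x = B x) : A = B := by
  have hD : D ≤ (A - B).ker := fun x hx => by simp [h₁ x hx]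
  have hD' : Dᗮ ≤ (A - B).ker := fun x hx => by simp [h₂ x hx]
  have hD'' : D.topologicalClosure ≤ (A - B).ker :=
    D.topologicalClosure_minimal hD (A - B).isClosed_ker
  ext x
  have hx := D.topologicalClosure.starProjection_add_starProjection_orthogonal x
  have h1 := hD'' (D.topologicalClosure.starProjection_apply_mem x)
  have h2 : D.topologicalClosureᗮ.starProjection x ∈ (A - B).ker := hD' (by
    rw [← Submodule.orthogonal_closure]
    exact D.topologicalClosureᗮ.starProjection_apply_mem x)
  have h3 := Submodule.add_mem _ h1 h2
  rw [hx] at h3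
  simpa [sub_eq_zero] using h3

theorem mem_of_forall_commutant {M : VonNeumannAlgebra H} {a : H →L[ℂ] H}
    (h : ∀ m ∈ M.commutant, m * a = a * m) : a ∈ M := by
  rw [← M.commutant_commutant, mem_commutant_iff]
  exact h

theorem starProjection_mem {M : VonNeumannAlgebra H} (K : Submodule ℂ H)
    [K.HasOrthogonalProjection] (h : ∀ m ∈ M.commutant, ∀ x ∈ K, m x ∈ K) :
    K.starProjection ∈ M := by
  rw [IsStarProjection.mem_iff isStarProjection_starProjection]
  intro m hm
  rw [Submodule.range_starProjection]
  exact fun x hx => h m hm x hx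

/-- A subspace of `H × H` that is the graph of an isometry and is invariant under the commutant
of `M` acting diagonally. -/
structure IsIsometryGraph (M : VonNeumannAlgebra H) (G : Submodule ℂ (H × H)) : Prop where
  norm_eq : ∀ p ∈ G, ‖p.1‖ = ‖p.2‖
  invariant : ∀ m ∈ M.commutant, ∀ p ∈ G, (m p.1, m p.2) ∈ G

theorem IsIsometryGraph.exists_partialIsometry {M : VonNeumannAlgebra H}
    {G : Submodule ℂ (H × H)} (hG : M.IsIsometryGraph G) :
    ∃ u ∈ M, (∀ p ∈ G, u p.1 = p.2) ∧ (∀ p ∈ G, star u p.2 = p.1) ∧ u * star u * u = u := by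
  let D : Submodule ℂ H := G.map (LinearMap.fst ℂ H H)
  have hD : ∀ p ∈ G, p.1 ∈ D := fun p hp => ⟨p, hp, rfl⟩
  let K := D.topologicalClosure
  let e : G →ₗ[ℂ] K := (LinearMap.fst ℂ H H ∘ₗ G.subtype).codRestrict K
    fun p => D.le_topologicalClosure (hD _ p.2)
  let f : G →ₗ[ℂ] H := LinearMap.snd ℂ H H ∘ₗ G.subtype
  have he : DenseRange e := by
    intro k
    rw [Metric.mem_closure_iff]
    intro ε hε
    obtain ⟨d, ⟨p, hp, rfl⟩, hd⟩ := Metric.mem_closure_iff.mp k.2 ε hε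
    exact ⟨e ⟨p, hp⟩, ⟨_, rfl⟩, hd⟩
  have hn : ∀ p, ‖f p‖ ≤ 1 * ‖e p‖ := fun p => by
    rw [one_mul]
    exact (hG.norm_eq _ p.2).ge
  let g := f.extendOfNorm e
  let u : H →L[ℂ] H := g ∘L K.orthogonalProjectionOnto
  have hu : ∀ p ∈ G, u p.1 = p.2 := fun p hp => by
    have h1 : K.orthogonalProjectionOnto p.1 = e ⟨p, hp⟩ :=
      K.orthogonalProjectionOnto_mem_subspace_eq_self (e ⟨p, hp⟩)
    change g (K.orthogonalProjectionOnto p.1) = p.2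
    rw [h1]
    exact LinearMap.extendOfNorm_eq he ⟨1, hn⟩ _
  have hu0 : ∀ x ∈ Dᗮ, u x = 0 := fun x hx => by
    have h1 : K.orthogonalProjectionOnto x = 0 := by
      rw [Submodule.orthogonalProjectionOnto_eq_zero_iff, Submodule.orthogonal_closure]
      exact hx
    change g (K.orthogonalProjectionOnto x) = 0
    rw [h1, map_zero]
  have hu1 : ∀ x, ‖u x‖ ≤ ‖x‖ := fun x =>
    (LinearMap.norm_extendOfNorm_apply_le he 1 hn _).trans (by
      rw [one_mul]
      exact K.norm_orthogonalProjectionOnto_apply_le x)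
  have hus1 : ∀ x, ‖star u x‖ ≤ ‖x‖ := fun x => by
    have : ‖star u‖ ≤ 1 := by
      rw [norm_star]
      exact u.opNorm_le_bound zero_le_one (by simpa using hu1)
    simpa using (star u).le_of_opNorm_le this x
  have hsu : ∀ p ∈ G, star u p.2 = p.1 := fun p hp => by
    have h1 : RCLike.re (inner ℂ (star u p.2) p.1) = ‖p.1‖ ^ 2 := by
      rw [ContinuousLinearMap.star_eq_adjoint, ContinuousLinearMap.adjoint_inner_left, hu p hp,
        inner_self_eq_norm_sq, hG.norm_eq p hp]
    have h2 := @norm_sub_sq ℂ _ _ _ _ (star u p.2) p.1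
    have h3 : ‖star u p.2‖ ≤ ‖p.1‖ := (hus1 _).trans (hG.norm_eq p hp).ge
    have h4 : ‖star u p.2 - p.1‖ ^ 2 ≤ 0 := by
      rw [h2, h1]
      nlinarith [norm_nonneg (star u p.2), norm_nonneg p.1]
    rw [← sub_eq_zero, ← norm_eq_zero]
    exact pow_eq_zero_iff two_ne_zero |>.mp (le_antisymm h4 (sq_nonneg _))
  refine ⟨u, mem_of_forall_commutant fun m hm => ?_, hu, hsu, ?_⟩
  · refine eq_of_eqOn_of_eqOn_orthogonal D ?_ fun x hx => ?_
    · rintro _ ⟨p, hp, rfl⟩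
      change m (u p.1) = u (m p.1)
      rw [hu p hp, hu _ (hG.invariant m hm p hp)]
    · change m (u x) = u (m x)
      rw [hu0 x hx, map_zero, hu0]
      rintro _ ⟨p, hp, rfl⟩
      rw [← ContinuousLinearMap.adjoint_inner_left]
      exact hx _ (hD _ (hG.invariant _ (star_mem hm) p hp))
  · refine eq_of_eqOn_of_eqOn_orthogonal D ?_ fun x hx => ?_
    · rintro _ ⟨p, hp, rfl⟩
      change u (star u (u p.1)) = u p.1
      rw [hu p hp, hsu p hp, hu p hp]
    · change u (star u (u x)) = u x
      simp [hu0 x hx]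

theorem abs_mem {M : VonNeumannAlgebra H} {a : H →L[ℂ] H} (ha : a ∈ M) : CFC.abs a ∈ M :=
  mem_of_forall_commutant fun m hm =>
    have h1 : Commute a m := mem_commutant_iff.mp hm a ha
    have h2 : Commute a (star m) := mem_commutant_iff.mp (star_mem hm) a ha
    (h1.cfcAbs_left h2).symm

theorem star_abs (a : H →L[ℂ] H) : star (CFC.abs a) = CFC.abs a :=
  (IsSelfAdjoint.of_nonneg (CFC.abs_nonneg a)).star_eq

theorem norm_abs_apply (a : H →L[ℂ] H) (x : H) : ‖CFC.abs a x‖ = ‖a x‖ := by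
  have h : ∀ b : H →L[ℂ] H, ‖b x‖ ^ 2 = RCLike.re (inner ℂ ((star b * b) x) x) := fun b => by
    rw [mul_apply_eq_comp, ContinuousLinearMap.star_eq_adjoint,
      ContinuousLinearMap.adjoint_inner_left, inner_self_eq_norm_sq]
  have h1 : ‖CFC.abs a x‖ ^ 2 = ‖a x‖ ^ 2 := by
    rw [h, h, star_abs, CFC.abs_mul_abs]
  exact (pow_left_inj₀ (norm_nonneg _) (norm_nonneg _) two_ne_zero).mp h1

/-- The graph of the partial isometry in the polar decomposition of `a`. -/
noncomputable def polarGraph (a : H →L[ℂ] H) : Submodule ℂ (H × H) :=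
  LinearMap.range ((CFC.abs a).prod a).toLinearMap

theorem mem_polarGraph (a : H →L[ℂ] H) (x : H) : (CFC.abs a x, a x) ∈ polarGraph a := ⟨x, rfl⟩

theorem isIsometryGraph_polarGraph {M : VonNeumannAlgebra H} {a : H →L[ℂ] H} (ha : a ∈ M) :
    M.IsIsometryGraph (polarGraph a) where
  norm_eq := by
    rintro _ ⟨x, rfl⟩
    exact norm_abs_apply a x
  invariant := by
    rintro m hm _ ⟨x, rfl⟩
    refine ⟨m x, Prod.ext ?_ ?_⟩
    · exact congr($(mem_commutant_iff.mp hm _ (abs_mem ha)) x)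
    · exact congr($(mem_commutant_iff.mp hm _ ha) x)

theorem IsIsometryGraph.sup {M : VonNeumannAlgebra H} {G G' : Submodule ℂ (H × H)}
    (hG : M.IsIsometryGraph G) (hG' : M.IsIsometryGraph G')
    (h₁ : ∀ p ∈ G, ∀ q ∈ G', inner ℂ p.1 q.1 = 0) (h₂ : ∀ p ∈ G, ∀ q ∈ G', inner ℂ p.2 q.2 = 0) :
    M.IsIsometryGraph (G ⊔ G') where
  norm_eq := by
    intro r hr
    obtain ⟨p, hp, q, hq, rfl⟩ := Submodule.mem_sup.mp hr
    have e1 := norm_add_sq_eq_norm_sq_add_norm_sq_of_inner_eq_zero p.1 q.1 (h₁ p hp q hq)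
    have e2 := norm_add_sq_eq_norm_sq_add_norm_sq_of_inner_eq_zero p.2 q.2 (h₂ p hp q hq)
    rw [hG.norm_eq p hp, hG'.norm_eq q hq, ← e2] at e1
    exact (mul_self_inj (norm_nonneg _) (norm_nonneg _)).mp e1
  invariant := by
    intro m hm r hr
    obtain ⟨p, hp, q, hq, rfl⟩ := Submodule.mem_sup.mp hr
    have := Submodule.add_mem_sup (hG.invariant m hm p hp) (hG'.invariant m hm q hq)
    simpa using this

theorem IsIsometryGraph.exists_maximal {M : VonNeumannAlgebra H} {G : Submodule ℂ (H × H)}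
    (hG : M.IsIsometryGraph G) : ∃ G', G ≤ G' ∧ Maximal (M.IsIsometryGraph ·) G' := by
  refine zorn_le_nonempty₀ {G | M.IsIsometryGraph G} (fun c hc hchain G₀ hG₀ => ?_) G hG
  have hmem : ∀ p, p ∈ sSup c ↔ ∃ G ∈ c, p ∈ G := fun p =>
    Submodule.mem_sSup_of_directed ⟨G₀, hG₀⟩ hchain.directedOn
  refine ⟨sSup c, ⟨fun p hp => ?_, fun m hm p hp => ?_⟩, fun _ => le_sSup⟩
  · obtain ⟨G, hGc, hpG⟩ := (hmem p).mp hp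
    exact (hc hGc).norm_eq p hpG
  · obtain ⟨G, hGc, hpG⟩ := (hmem p).mp hp
    exact (hmem _).mpr ⟨G, hGc, (hc hGc).invariant m hm p hpG⟩

/-- If the defects `1 - star u * u` and `1 - u * star u` of an element `u` of a finite von Neumann
algebra are centrally orthogonal, then `u` is an isometry. -/
theorem star_mul_self_eq_one_of_centrally_orthogonal {M : VonNeumannAlgebra H}
    (hM : ∀ V ∈ M, star V * V = (1 : H →L[ℂ] H) → V * star V = 1) {u : H →L[ℂ] H} (hu : u ∈ M)
    (h : ∀ a ∈ M, (1 - u * star u) * a * (1 - star u * u) = 0) : star u * u = 1 := by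
  let K : Submodule ℂ H := ⨅ a : M, ((1 - u * star u) * (a : H →L[ℂ] H)).ker
  have hKmem : ∀ x, x ∈ K ↔ ∀ a ∈ M, (1 - u * star u) (a x) = 0 := fun x => by
    simp [K, Submodule.mem_iInf]
  have hKc : IsClosed (K : Set H) := by
    simp only [K, Submodule.coe_iInf]
    exact isClosed_iInter fun a => ContinuousLinearMap.isClosed_ker _
  have : CompleteSpace K := hKc.completeSpace_coe
  have hF : 1 - u * star u ∈ M := sub_mem (one_mem M) (mul_mem hu (star_mem hu))
  have hzM : K.starProjection ∈ M := starProjection_mem K fun m hm x hx => by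
    rw [hKmem] at hx ⊢
    intro a ha
    have h1 := congr($(mem_commutant_iff.mp hm _ (mul_mem hF ha)) x)
    have h2 : (1 - u * star u) (a (m x)) = m ((1 - u * star u) (a x)) := h1
    rw [h2, hx a ha, map_zero]
  have hzM' : K.starProjection ∈ M.commutant := starProjection_mem K fun m hm x hx => by
    rw [commutant_commutant] at hm
    rw [hKmem] at hx ⊢
    exact fun a ha => hx (a * m) (mul_mem ha hm)
  have hz := isStarProjection_starProjection (U := K)
  have hzE : K.starProjection * (1 - star u * u) = 1 - star u * u := by
    ext x
    exact Submodule.starProjection_eq_self_iff.mpr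
      ((hKmem _).mpr fun a ha => congr($(h a ha) x))
  have hFz : (1 - u * star u) * K.starProjection = 0 := by
    ext x
    exact (hKmem _).mp (K.starProjection_apply_mem x) 1 (one_mem M)
  generalize K.starProjection = z at hzM hzM' hz hzE hFz
  have hzu : u * z = z * u := mem_commutant_iff.mp hzM' u hu
  have hzu' : star u * z = z * star u := mem_commutant_iff.mp hzM' _ (star_mem hu)
  have hzz : z * z = z := hz.isIdempotentElem
  have hsz : star z = z := hz.isSelfAdjoint
  have hzuu : z * (u * star u) = z := by
    have : u * star u * z = z := by
      rw [sub_mul, one_mul, sub_eq_zero] at hFz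
      exact hFz.symm
    rw [← mul_assoc, ← hzu, mul_assoc, ← hzu', ← mul_assoc, this]
  have hV : z * star u + (1 - z) ∈ M :=
    add_mem (mul_mem hzM (star_mem hu)) (sub_mem (one_mem M) hzM)
  have hVs : star (z * star u + (1 - z)) = z * u + (1 - z) := by
    simp [hsz, hzu]
  have h1 : (z * u + (1 - z)) * (z * star u + (1 - z)) = 1 := by
    have e1 : z * u * (z * star u) = z := by
      rw [← hzu, mul_assoc u, ← mul_assoc z, hzz, ← mul_assoc, hzu, mul_assoc, hzuu]
    have e2 : z * u * (1 - z) = 0 := by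
      rw [mul_sub, mul_one, mul_assoc, hzu, ← mul_assoc, hzz, sub_self]
    have e3 : (1 - z) * (z * star u) = 0 := by
      rw [← mul_assoc, sub_mul, one_mul, hzz, sub_self, zero_mul]
    have e4 : (1 - z) * (1 - z) = 1 - z := by
      rw [mul_sub, mul_one, sub_mul, one_mul, hzz, sub_self, sub_zero]
    rw [add_mul, mul_add, mul_add, e1, e2, e3, e4]
    abel
  have h2 := hM _ hV (by rw [hVs, h1])
  rw [hVs] at h2
  have h3 : z * (star u * u) = z := by
    have e1 : z * star u * (z * u) = z * (star u * u) := by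
      rw [← hzu', mul_assoc, ← mul_assoc z, hzz, ← mul_assoc, hzu', mul_assoc]
    have e2 : z * ((z * star u + (1 - z)) * (z * u + (1 - z))) * z = z * (star u * u) := by
      have e3 : z * (z * star u + (1 - z)) = z * star u := by
        rw [mul_add, ← mul_assoc, mul_sub, mul_one, hzz, sub_self, add_zero]
      have e4 : (z * u + (1 - z)) * z = z * u := by
        rw [add_mul, mul_assoc, hzu, ← mul_assoc, hzz, sub_mul, one_mul, hzz, sub_self, add_zero]
      rw [← mul_assoc, e3, mul_assoc, e4, e1]
    rw [← e2, h2, mul_one, hzz]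
  rw [mul_sub, mul_one, h3, sub_self] at hzE
  exact (sub_eq_zero.mp hzE.symm).symm

/-- In a finite von Neumann algebra every partial isometry extends to a unitary. -/
theorem IsIsometryGraph.exists_unitary {M : VonNeumannAlgebra H}
    (hM : ∀ V ∈ M, star V * V = (1 : H →L[ℂ] H) → V * star V = 1)
    {G : Submodule ℂ (H × H)} (hG : M.IsIsometryGraph G) :
    ∃ W ∈ M, star W * W = 1 ∧ W * star W = 1 ∧ ∀ p ∈ G, W p.1 = p.2 := by
  obtain ⟨G', hGG', hG', hmax⟩ := hG.exists_maximal
  obtain ⟨u, huM, hu, hsu, huu⟩ := hG'.exists_partialIsometry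
  suffices h : star u * u = 1 from ⟨u, huM, h, hM u huM h, fun p hp => hu p (hGG' hp)⟩
  refine star_mul_self_eq_one_of_centrally_orthogonal hM huM fun a ha => ?_
  let b := (1 - u * star u) * a * (1 - star u * u)
  have hbM : b ∈ M := mul_mem (mul_mem (sub_mem (one_mem M) (mul_mem huM (star_mem huM))) ha)
    (sub_mem (one_mem M) (mul_mem (star_mem huM) huM))
  have hub : star u * b = 0 := by
    have : star u * u * star u = star u := by
      simpa [mul_assoc] using congr(star $huu)
    have h0 : star u * (1 - u * star u) = 0 := by
      rw [mul_sub, mul_one, ← mul_assoc, this, sub_self]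
    change star u * ((1 - u * star u) * a * (1 - star u * u)) = 0
    rw [← mul_assoc, ← mul_assoc, h0, zero_mul, zero_mul]
  have hb1 : ∀ p ∈ G', b p.1 = 0 := fun p hp => by
    have : (1 - star u * u) p.1 = 0 := by simp [hu p hp, hsu p hp]
    change (1 - u * star u) (a ((1 - star u * u) p.1)) = 0
    rw [this, map_zero, map_zero]
  have hsup : M.IsIsometryGraph (G' ⊔ polarGraph b) := by
    refine hG'.sup (isIsometryGraph_polarGraph hbM) ?_ ?_
    · rintro p hp _ ⟨x, rfl⟩
      change inner ℂ p.1 (CFC.abs b x) = 0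
      rw [← star_abs, ContinuousLinearMap.star_eq_adjoint,
        ContinuousLinearMap.adjoint_inner_right,
        norm_eq_zero.mp ((norm_abs_apply b p.1).trans (by rw [hb1 p hp, norm_zero])),
        inner_zero_left]
    · rintro p hp _ ⟨x, rfl⟩
      change inner ℂ p.2 (b x) = 0
      have : star u (b x) = 0 := congr($hub x)
      rw [← hu p hp, ← ContinuousLinearMap.adjoint_inner_right,
        ← ContinuousLinearMap.star_eq_adjoint, this, inner_zero_right]
  have hle := hmax hsup le_sup_left
  ext x
  have hx : (CFC.abs b x, b x) ∈ G' := hle (Submodule.mem_sup_right (mem_polarGraph b x))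
  have h1 := hsu _ hx
  have h2 : star u (b x) = 0 := congr($hub x)
  have h3 : CFC.abs b x = 0 := h1.symm.trans h2
  change b x = 0
  rw [← norm_eq_zero, ← norm_abs_apply, h3, norm_zero]

/-- In a finite von Neumann algebra the kernel projections of `a` and `star a` are unitarily
equivalent. -/
theorem exists_kernel_projection {M : VonNeumannAlgebra H}
    (hM : ∀ V ∈ M, star V * V = (1 : H →L[ℂ] H) → V * star V = 1)
    {a : H →L[ℂ] H} (ha : a ∈ M) :
    ∃ N ∈ M, ∃ W ∈ M, IsStarProjection N ∧ star W * W = 1 ∧ W * star W = 1 ∧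
      (∀ y, a * y = 0 ↔ N * y = y) ∧ ∀ y, star a * y = 0 ↔ W * N * star W * y = y := by
  obtain ⟨W, hWM, hW1, hW2, hW⟩ := (isIsometryGraph_polarGraph ha).exists_unitary hM
  have hWa : W * CFC.abs a = a := by
    ext x
    exact hW _ (mem_polarGraph a x)
  have hclosed : IsClosed (a.ker : Set H) := a.isClosed_ker
  have : CompleteSpace a.ker := hclosed.completeSpace_coe
  have hN : ∀ y, a * y = 0 ↔ a.ker.starProjection * y = y := fun y => by
    simp only [ContinuousLinearMap.ext_iff]
    exact forall_congr' fun x => (Submodule.starProjection_eq_self_iff (K := a.ker)).symm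
  refine ⟨a.ker.starProjection, starProjection_mem _ fun m hm x hx => ?_, W, hWM,
    isStarProjection_starProjection, hW1, hW2, hN, fun y => ?_⟩
  · have h1 : a (m x) = m (a x) := congr($(mem_commutant_iff.mp hm a ha) x)
    have h2 : a x = 0 := hx
    change a (m x) = 0
    rw [h1, h2, map_zero]
  · have hsa : star a = CFC.abs a * star W := by
      conv_lhs => rw [← hWa, star_mul, star_abs]
    have h1 : star a * y = 0 ↔ a * (star W * y) = 0 := by
      constructor
      · intro h
        rw [hsa, mul_assoc] at h
        rw [← hWa, mul_assoc, h, mul_zero]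
      · intro h
        rw [← hWa, mul_assoc] at h
        have := congr(star W * $h)
        rwa [← mul_assoc, hW1, one_mul, mul_zero, ← mul_assoc, ← hsa] at this
    rw [h1, hN]
    constructor
    · intro h
      rw [mul_assoc, mul_assoc, h, ← mul_assoc, hW2, one_mul]
    · intro h
      have := congr(star W * $h)
      rwa [← mul_assoc, ← mul_assoc, ← mul_assoc, hW1, one_mul, mul_assoc] at this

/-- Every element of a finite von Neumann algebra is the sum of a projection and an element without
right annihilator. -/
theorem exists_projection_sub_injective {M : VonNeumannAlgebra H}
    (hM : ∀ V ∈ M, star V * V = (1 : H →L[ℂ] H) → V * star V = 1)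
    {T : H →L[ℂ] H} (hT : T ∈ M) :
    ∃ P ∈ M, IsStarProjection P ∧ ∀ y, (T - P) * y = 0 → y = 0 := by
  obtain ⟨Q, hQM, U, hUM, hQ, hU1, hU2, hTQ, hTS⟩ := exists_kernel_projection hM hT
  have hQ2 : Q * Q = Q := hQ.isIdempotentElem
  have hQs : star Q = Q := hQ.isSelfAdjoint
  obtain ⟨S, hS⟩ : ∃ S, S = U * Q * star U := ⟨_, rfl⟩
  have hSM : S ∈ M := hS ▸ mul_mem (mul_mem hUM hQM) (star_mem hUM)
  have hS2 : S * S = S := by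
    rw [hS, show U * Q * star U * (U * Q * star U) = U * Q * (star U * U) * Q * star U by
      simp only [mul_assoc], hU1, mul_one, mul_assoc U Q Q, hQ2]
  have hSs : star S = S := by simp [hS, hQs, mul_assoc]
  rw [← hS] at hTS
  have hTQ0 : T * Q = 0 := (hTQ Q).mpr hQ2
  have hTS0 : star T * S = 0 := (hTS S).mpr hS2
  have hST0 : S * T = 0 := by simpa [hSs] using congr(star $hTS0)
  have hQT0 : Q * star T = 0 := by simpa [hQs] using congr(star $hTQ0)
  obtain ⟨Q₁, hQ₁M, W, hWM, hQ₁, hW1, hW2, hXQ, hXS⟩ :=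
    exists_kernel_projection hM (add_mem (mul_mem hSM hQM) hT)
  have hQ₁2 : Q₁ * Q₁ = Q₁ := hQ₁.isIdempotentElem
  have hQ₁s : star Q₁ = Q₁ := hQ₁.isSelfAdjoint
  have hX0 : S * Q * Q₁ + T * Q₁ = 0 := by
    rw [← add_mul]
    exact (hXQ Q₁).mpr hQ₁2
  have hSQQ₁ : S * Q * Q₁ = 0 := by
    have := congr(S * $hX0)
    rwa [mul_add, ← mul_assoc, ← mul_assoc, ← mul_assoc, hS2, hST0, zero_mul, add_zero,
      mul_zero] at this
  have hQQ₁ : Q * Q₁ = Q₁ := by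
    rw [hSQQ₁, zero_add] at hX0
    exact (hTQ Q₁).mp hX0
  have hSQ₁ : S * Q₁ = 0 := by rwa [mul_assoc, hQQ₁] at hSQQ₁
  have hQ₁Q : Q₁ * Q = Q₁ := by simpa [hQs, hQ₁s] using congr(star $hQQ₁)
  obtain ⟨S₁, hS₁⟩ : ∃ S₁, S₁ = W * Q₁ * star W := ⟨_, rfl⟩
  have hS₁2 : S₁ * S₁ = S₁ := by
    rw [hS₁, show W * Q₁ * star W * (W * Q₁ * star W) = W * Q₁ * (star W * W) * Q₁ * star W by
      simp only [mul_assoc], hW1, mul_one, mul_assoc W Q₁ Q₁, hQ₁2]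
  have hS₁s : star S₁ = S₁ := by simp [hS₁, hQ₁s, mul_assoc]
  rw [← hS₁] at hXS
  have hX0' : Q * S * S₁ + star T * S₁ = 0 := by
    have := (hXS S₁).mpr hS₁2
    rwa [star_add, star_mul, hQs, hSs, add_mul] at this
  have hQSS₁ : Q * S * S₁ = 0 := by
    have := congr(Q * $hX0')
    rwa [mul_add, ← mul_assoc, ← mul_assoc, ← mul_assoc, hQ2, hQT0, zero_mul, add_zero,
      mul_zero] at this
  have hSS₁ : S * S₁ = S₁ := by
    rw [hQSS₁, zero_add] at hX0'
    exact (hTS S₁).mp hX0'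
  have hQS₁ : Q * S₁ = 0 := by rwa [mul_assoc, hSS₁] at hQSS₁
  have hS₁S : S₁ * S = S₁ := by simpa [hSs, hS₁s] using congr(star $hSS₁)
  have hS₁Q : S₁ * Q = 0 := by simpa [hQs, hS₁s] using congr(star $hQS₁)
  have hS₁Q₁ : S₁ * Q₁ = 0 := by rw [← hQQ₁, ← mul_assoc, hS₁Q, zero_mul]
  -- `v` is a partial isometry from `Q₁` to `S₁`
  obtain ⟨v, hv⟩ : ∃ v, v = W * Q₁ := ⟨_, rfl⟩
  have hvM : v ∈ M := hv ▸ mul_mem hWM hQ₁M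
  have hvQ₁ : v * Q₁ = v := by rw [hv, mul_assoc, hQ₁2]
  have hvs : star v = Q₁ * star W := by rw [hv, star_mul, hQ₁s]
  have hv1 : star v * v = Q₁ := by
    rw [hvs, hv, mul_assoc, ← mul_assoc (star W), hW1, one_mul, hQ₁2]
  have hv2 : v * star v = S₁ := by
    rw [hvs, hv, hS₁, mul_assoc W, ← mul_assoc Q₁, hQ₁2, mul_assoc]
  have hS₁v : S₁ * v = v := by rw [← hv2, mul_assoc, hv1, hvQ₁]
  have hvS₁ : star v * S₁ = star v := by simpa [hS₁s] using congr(star $hS₁v)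
  have hSv : S * v = v := by rw [← hS₁v, ← mul_assoc, hSS₁]
  have hQv : Q * v = 0 := by rw [← hS₁v, ← mul_assoc, hQS₁, zero_mul]
  have hQ₁v : Q₁ * v = 0 := by rw [← hQ₁Q, mul_assoc, hQv, mul_zero]
  have hvsQ₁ : star v * Q₁ = 0 := by simpa [hQ₁s] using congr(star $hQ₁v)
  -- the projection onto the graph of `v` is `g * star g / 2`
  obtain ⟨g, hg⟩ : ∃ g, g = Q₁ + v := ⟨_, rfl⟩
  have hgM : g ∈ M := hg ▸ add_mem hQ₁M hvM
  have hgs : star g = Q₁ + star v := by rw [hg, star_add, hQ₁s]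
  have hgg : star g * g = Q₁ + Q₁ := by
    rw [hgs, hg, add_mul, mul_add, mul_add, hQ₁2, hQ₁v, hvsQ₁, hv1, add_zero, zero_add]
  have hgQ₁ : g * Q₁ = g := by rw [hg, add_mul, hQ₁2, hvQ₁]
  have hSg : S * g = v := by rw [hg, mul_add, hSQ₁, hSv, zero_add]
  have hQg : Q * g = Q₁ := by rw [hg, mul_add, hQQ₁, hQv, add_zero]
  have hQ₁g : Q₁ * g = Q₁ := by rw [hg, mul_add, hQ₁2, hQ₁v, add_zero]
  let R : H →L[ℂ] H := (2⁻¹ : ℂ) • (g * star g)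
  have hRM : R ∈ M := M.toStarSubalgebra.smul_mem (mul_mem hgM (star_mem hgM)) _
  have hR : IsStarProjection R := by
    refine ⟨?_, ?_⟩
    · have : g * star g * (g * star g) = (2 : ℂ) • (g * star g) := by
        rw [mul_assoc, ← mul_assoc (star g), hgg, add_mul, mul_add, ← mul_assoc, hgQ₁, two_smul]
      change ((2⁻¹ : ℂ) • (g * star g)) * ((2⁻¹ : ℂ) • (g * star g)) = (2⁻¹ : ℂ) • (g * star g)
      rw [smul_mul_smul_comm, this, smul_smul]
      norm_num
    · change star ((2⁻¹ : ℂ) • (g * star g)) = (2⁻¹ : ℂ) • (g * star g)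
      simp
  have hQR : (Q - Q₁) * R = 0 := by
    change (Q - Q₁) * ((2⁻¹ : ℂ) • (g * star g)) = 0
    rw [mul_smul_comm, ← mul_assoc, sub_mul, hQg, hQ₁g, sub_self, zero_mul, smul_zero]
  refine ⟨Q - Q₁ + R, add_mem (sub_mem hQM hQ₁M) hRM,
    (hQ₁.sub_of_mul_eq_left hQ hQ₁Q).add hR hQR, fun y hy => ?_⟩
  have hTy : T * y = (Q - Q₁ + R) * y := by rwa [sub_mul, sub_eq_zero] at hy
  have hSR : S * R = (2⁻¹ : ℂ) • (v + S₁) := by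
    change S * ((2⁻¹ : ℂ) • (g * star g)) = _
    rw [mul_smul_comm, ← mul_assoc, hSg, hgs, mul_add, hvQ₁, hv2]
  have h1 : S * Q * y + (2⁻¹ : ℂ) • ((v + S₁) * y) = 0 := by
    have := congr(S * $hTy)
    rw [← mul_assoc, hST0, zero_mul, ← mul_assoc, mul_add, mul_sub, hSQ₁, sub_zero, hSR, add_mul,
      smul_mul_assoc] at this
    exact this.symm
  have h2 : (v + S₁) * y = 0 := by
    have := congr(S₁ * $h1)
    rw [mul_add, ← mul_assoc, ← mul_assoc, hS₁S, hS₁Q, zero_mul, zero_add, mul_smul_comm,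
      ← mul_assoc, mul_add, hS₁v, hS₁2, mul_zero] at this
    exact (smul_eq_zero.mp this).resolve_left (by norm_num)
  have h3 : S * Q * y = 0 := by rwa [h2, smul_zero, add_zero] at h1
  have h4 : star g * y = 0 := by
    have := congr(star v * $h2)
    rwa [← mul_assoc, mul_add, hv1, hvS₁, ← hgs, mul_zero] at this
  have h5 : Q₁ * y = Q * y := by
    have : (S * Q + T) * (Q * y) = 0 := by
      rw [add_mul, ← mul_assoc, ← mul_assoc, mul_assoc S, hQ2, h3, hTQ0, zero_mul, add_zero]
    have := (hXQ _).mp this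
    rwa [← mul_assoc, hQ₁Q] at this
  have h6 : T * y = 0 := by
    have hRy : R * y = 0 := by
      change ((2⁻¹ : ℂ) • (g * star g)) * y = 0
      rw [smul_mul_assoc, mul_assoc, h4, mul_zero, smul_zero]
    rw [hTy, add_mul, sub_mul, h5, sub_self, hRy, add_zero]
  have h7 : Q₁ * y = y := h5.trans ((hTQ y).mp h6)
  have h8 : star g * Q₁ = Q₁ := by rw [hgs, add_mul, hQ₁2, hvsQ₁, add_zero]
  rw [← h7, ← mul_assoc, h8, h7] at h4
  exact h4

/-- In a finite von Neumann algebra an element without right annihilator has no left annihilator. -/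
theorem eq_zero_of_mul_eq_zero {M : VonNeumannAlgebra H}
    (hM : ∀ V ∈ M, star V * V = (1 : H →L[ℂ] H) → V * star V = 1)
    {a : H →L[ℂ] H} (ha : a ∈ M) (h : ∀ y, a * y = 0 → y = 0) {y : H →L[ℂ] H}
    (hy : y * a = 0) : y = 0 := by
  obtain ⟨N, -, W, -, hN, -, -, h1, h2⟩ := exists_kernel_projection hM ha
  have hN0 : N = 0 := h N ((h1 N).mpr hN.isIdempotentElem)
  have h3 := (h2 (star y)).mp (by rw [← star_mul, hy, star_zero])
  rw [hN0, mul_zero, zero_mul, zero_mul] at h3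
  exact star_eq_zero.mp h3.symm

/-- If `P` is a contraction and `V` a non-unitary isometry, then `2 • V - P` has a left
annihilator. -/
theorem mul_star_self_eq_one_of_two_smul_sub {M : VonNeumannAlgebra H} {V P : H →L[ℂ] H}
    (hV : V ∈ M) (hP : P ∈ M) (hVV : star V * V = 1) (hP1 : ‖P‖ ≤ 1)
    (h : ∀ y ∈ M, y * ((2 : ℂ) • V - P) = 0 → y = 0) : V * star V = 1 := by
  let A := (2 : ℂ) • V - P
  have hVs : ‖star V‖ ≤ 1 := by
    have h1 : ‖V‖ * ‖V‖ ≤ 1 := by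
      rw [← CStarRing.norm_star_mul_self, hVV]
      exact ContinuousLinearMap.norm_id_le
    rw [norm_star]
    nlinarith [norm_nonneg V]
  have hlt : ‖(2⁻¹ : ℂ) • (star V * P)‖ < 1 := by
    have h1 : ‖star V * P‖ ≤ 1 :=
      (norm_mul_le _ _).trans (mul_le_one₀ hVs (norm_nonneg _) hP1)
    rw [norm_smul, norm_inv, RCLike.norm_ofNat]
    linarith
  let u := Units.oneSub _ hlt
  have hu : star V * A = (2 : ℂ) • (u : H →L[ℂ] H) := by
    change star V * ((2 : ℂ) • V - P) = (2 : ℂ) • (1 - (2⁻¹ : ℂ) • (star V * P))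
    rw [mul_sub, mul_smul_comm, hVV, smul_sub, smul_smul, mul_inv_cancel₀ two_ne_zero, one_smul]
  have huM : (u : H →L[ℂ] H) ∈ M := sub_mem (one_mem M)
    (M.toStarSubalgebra.smul_mem (mul_mem (star_mem hV) hP) _)
  have huM' : ((u⁻¹ : (H →L[ℂ] H)ˣ) : H →L[ℂ] H) ∈ M := mem_of_forall_commutant fun m hm =>
    (Commute.units_inv_right (u := u) (mem_commutant_iff.mp hm _ huM).symm :)
  have hAM : A ∈ M := sub_mem (M.toStarSubalgebra.smul_mem hV _) hP
  let B := (2⁻¹ : ℂ) • ((u⁻¹ : (H →L[ℂ] H)ˣ) : H →L[ℂ] H)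
  have hBM : B ∈ M := M.toStarSubalgebra.smul_mem huM' _
  have hB : B * (star V * A) = 1 := by
    rw [hu]
    change ((2⁻¹ : ℂ) • ((u⁻¹ : (H →L[ℂ] H)ˣ) : H →L[ℂ] H)) * _ = 1
    rw [smul_mul_smul_comm, u.inv_mul]
    norm_num
  have h1 := h (1 - A * B * star V)
    (sub_mem (one_mem M) (mul_mem (mul_mem hAM hBM) (star_mem hV))) (by
      change (1 - A * B * star V) * A = 0
      rw [sub_mul, one_mul, mul_assoc, mul_assoc, hB, mul_one, sub_self])
  have h2 : A * B * star V = 1 := (sub_eq_zero.mp h1).symm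
  have h3 : A * B = V := by rw [← mul_one (A * B), ← hVV, ← mul_assoc, h2, one_mul]
  rwa [h3] at h2

end VonNeumannAlgebra

/-- A von Neumann algebra is almost `*`-clean (every element is the sum of a projection
and a non-zero-divisor) if and only if it is finite (every isometry is unitary). -/
theorem stmt12 (M : VonNeumannAlgebra H) :
    (∀ T ∈ M, ∃ P ∈ M, IsSelfAdjoint P ∧ IsIdempotentElem P ∧
        (∀ y ∈ M, (T - P) * y = 0 → y = 0) ∧ (∀ y ∈ M, y * (T - P) = 0 → y = 0)) ↔
      (∀ V ∈ M, star V * V = (1 : H →L[ℂ] H) → V * star V = 1) := by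
  constructor
  · intro h V hV hVV
    obtain ⟨P, hPM, hPs, hPi, -, hy⟩ := h ((2 : ℂ) • V) (M.toStarSubalgebra.smul_mem hV _)
    exact VonNeumannAlgebra.mul_star_self_eq_one_of_two_smul_sub hV hPM hVV
      (IsStarProjection.norm_le P ⟨hPi, hPs⟩) hy
  · intro hM T hT
    obtain ⟨P, hPM, hP, hinj⟩ := VonNeumannAlgebra.exists_projection_sub_injective hM hT
    exact ⟨P, hPM, hP.isSelfAdjoint, hP.isIdempotentElem, fun y _ => hinj y, fun y _ =>
      VonNeumannAlgebra.eq_zero_of_mul_eq_zero hM (sub_mem hT hPM) hinj⟩
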